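/- For a library of D > 2 files, every file rate R_s achievable with strong secrecy satisfies R_s ≤ 1/2 + ((2D−1)/(2D(D−1)))·(1−α) when 0 < α < 1, and R_s ≤ 1 − α/2 when 1 ≤ α ≤ 2. -/

import Mathlib

open scoped BigOperators
open Filter

namespace CBC

/-- The distribution of a random variable `X` on a finite sample space with
probability mass function `P`. -/
noncomputable def dist {Ω A : Type*} [Fintype Ω] [DecidableEq A]
    (P : Ω → ℝ) (X : Ω → A) (a : A) : ℝ :=
  ∑ ω, if X ω = a then P ω else 0

/-- Mutual information `I(X;Y)` of two finite-valued random variables on a finite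
sample space with probability mass function `P`:
`I(X;Y) = Σ_{a,b} P(X=a,Y=b) log ( P(X=a,Y=b) / (P(X=a) P(Y=b)) )`. -/
noncomputable def mutInfo {Ω A B : Type*} [Fintype Ω] [Fintype A] [Fintype B]
    [DecidableEq A] [DecidableEq B] (P : Ω → ℝ) (X : Ω → A) (Y : Ω → B) : ℝ :=
  ∑ a : A, ∑ b : B,
    dist P (fun ω => (X ω, Y ω)) (a, b) *
      Real.log (dist P (fun ω => (X ω, Y ω)) (a, b) / (dist P X a * dist P Y b))

/-- A channel code for the caching broadcast channel with a wire and cache tapping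
adversary of type II (CBC-WCT II), with library size `D`, blocklength `n`,
message-set size `M` (so each file is uniform over `Fin M`, representing
`[1:2^{nR_s}]`) and cache size `C` (representing `[1:2^{n/2}]`).
Encoders may use private randomness: a finite randomness alphabet `Fin (nr+1)`
with probability mass function `q`. -/
structure Code (D n M C : ℕ) where
  /-- size (minus one) of the encoder's private randomness alphabet -/
  nr : ℕ
  /-- probability mass function of the encoder's private randomness -/
  q : Fin (nr + 1) → ℝ
  q_nonneg : ∀ θ, 0 ≤ q θ
  q_sum : ∑ θ, q θ = 1
  /-- cache placement encoder: sends `X_c^n ∈ {0,1}^n` as a (stochastic) function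
  of the library files -/
  encC : (Fin D → Fin M) → Fin (nr + 1) → (Fin n → Bool)
  /-- cache decoder of receiver `j ∈ {1,2}`: stores `M_{c,j} = f_{c,j}(X_c^n)` -/
  cacheF : Fin 2 → (Fin n → Bool) → Fin C
  /-- delivery encoder for demand vector `d = (d₁,d₂)`: sends `X_d^n ∈ {0,1}^n` -/
  encD : Fin D × Fin D → (Fin D → Fin M) → Fin (nr + 1) → (Fin n → Bool)
  /-- decoder of receiver `j`: `Ŵ_{d_j} = g_{d,j}(M_{c,j}, X_d^n)` -/
  dec : Fin D × Fin D → Fin 2 → Fin C → (Fin n → Bool) → Fin M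

/-- The joint probability mass function of the (independent, uniform) library files
and the encoder randomness. -/
noncomputable def Code.P {D n M C : ℕ} (c : Code D n M C) :
    ((Fin D → Fin M) × Fin (c.nr + 1)) → ℝ :=
  fun ωθ => (1 / (M : ℝ) ^ D) * c.q ωθ.2

/-- Probability of decoding error under demand vector `d`:
`P(Ŵ_{d₁} ≠ W_{d₁} or Ŵ_{d₂} ≠ W_{d₂})`. -/
noncomputable def Code.errProb {D n M C : ℕ} (c : Code D n M C)
    (d : Fin D × Fin D) : ℝ :=
  ∑ ωθ : (Fin D → Fin M) × Fin (c.nr + 1),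
    if c.dec d 0 (c.cacheF 0 (c.encC ωθ.1 ωθ.2)) (c.encD d ωθ.1 ωθ.2) ≠ ωθ.1 d.1 ∨
       c.dec d 1 (c.cacheF 1 (c.encC ωθ.1 ωθ.2)) (c.encD d ωθ.1 ωθ.2) ≠ ωθ.1 d.2
    then c.P ωθ else 0

/-- The adversary's observation of a length-`n` binary word when tapping the
positions in `S`: position `i` shows the transmitted bit if `i ∈ S` and the
erasure symbol `?` (here `none`) otherwise. -/
def tap {n : ℕ} (S : Finset (Fin n)) (x : Fin n → Bool) : Fin n → Option Bool :=
  fun i => if i ∈ S then some (x i) else none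

/-- Information leakage `I(W₁,…,W_D ; Z_{S₁}^n, Z_{S₂}^n)` to an adversary tapping
positions `S₁` of the cache placement transmission and `S₂` of the delivery
transmission, under demand vector `d`. -/
noncomputable def Code.leak {D n M C : ℕ} (c : Code D n M C)
    (d : Fin D × Fin D) (S1 S2 : Finset (Fin n)) : ℝ :=
  mutInfo c.P (fun ωθ => ωθ.1)
    (fun ωθ => (tap S1 (c.encC ωθ.1 ωθ.2), tap S2 (c.encD d ωθ.1 ωθ.2)))

/-- Number of messages per file at blocklength `n` and file rate `R`: `2^{nR}`. -/
noncomputable def msgCount (n : ℕ) (R : ℝ) : ℕ := ⌊(2 : ℝ) ^ ((n : ℝ) * R)⌋₊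

/-- Size of each receiver's cache memory at blocklength `n`: `2^{n/2}`
(a cache of `n/2` bits). -/
noncomputable def cacheSize (n : ℕ) : ℕ := ⌊(2 : ℝ) ^ ((n : ℝ) / 2)⌋₊

/-- The file rate `R` is achievable with strong secrecy with respect to the family
`Allowed` of admissible adversary tapping-set pairs `(S₁,S₂)`: there is a sequence
of codes whose worst-case (over demand vectors) error probability vanishes and
whose worst-case (over demand vectors and allowed tapping sets) information
leakage vanishes as `n → ∞`. -/
def AchievableW (D : ℕ)
    (Allowed : (n : ℕ) → Finset (Fin n) → Finset (Fin n) → Prop) (R : ℝ) : Prop :=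
  ∃ (c : ∀ n : ℕ, Code D n (msgCount n R) (cacheSize n)) (ε δ : ℕ → ℝ),
    Tendsto ε atTop (nhds 0) ∧ Tendsto δ atTop (nhds 0) ∧
    (∀ n, ∀ d : Fin D × Fin D, (c n).errProb d ≤ ε n) ∧
    (∀ n, ∀ d : Fin D × Fin D, ∀ S1 S2 : Finset (Fin n), Allowed n S1 S2 →
      |(c n).leak d S1 S2| ≤ δ n)

/-- The file rate `R` is achievable with strong secrecy against an adversary of
type II who may tap any sets `S₁, S₂ ⊆ [1:n]` with `|S₁| + |S₂| ≤ μ = αn`. -/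
def Achievable (D : ℕ) (α : ℝ) (R : ℝ) : Prop :=
  AchievableW D (fun n S1 S2 => ((S1.card : ℝ) + (S2.card : ℝ)) ≤ α * n) R

/-- The strong secrecy capacity `C_s(α)` of the CBC-WCT II with library size `D`:
the supremum of all file rates achievable with strong secrecy. -/
noncomputable def capacity (D : ℕ) (α : ℝ) : ℝ :=
  sSup {R : ℝ | Achievable D α R}

end CBC

namespace CBC

lemma sum_dist_mul {Ω A : Type*} [Fintype Ω] [Fintype A] [DecidableEq A]
    (P : Ω → ℝ) (X : Ω → A) (f : A → ℝ) :
    ∑ a, dist P X a * f a = ∑ ω, P ω * f (X ω) := by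
  simp only [dist, Finset.sum_mul, ite_mul, zero_mul]
  rw [Finset.sum_comm]
  simp

lemma sum_dist {Ω A : Type*} [Fintype Ω] [Fintype A] [DecidableEq A]
    (P : Ω → ℝ) (X : Ω → A) : ∑ a, dist P X a = ∑ ω, P ω := by
  simpa using sum_dist_mul P X (fun _ => 1)

lemma dist_nonneg {Ω A : Type*} [Fintype Ω] [DecidableEq A]
    {P : Ω → ℝ} (hP : ∀ ω, 0 ≤ P ω) (X : Ω → A) (a : A) : 0 ≤ dist P X a :=
  Finset.sum_nonneg fun ω _ => by split_ifs <;> simp [hP]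

lemma dist_comp_le {Ω A B : Type*} [Fintype Ω] [DecidableEq A] [DecidableEq B]
    {P : Ω → ℝ} (hP : ∀ ω, 0 ≤ P ω) (X : Ω → A) (g : A → B) (a : A) :
    dist P X a ≤ dist P (fun ω => g (X ω)) (g a) := by
  refine Finset.sum_le_sum fun ω _ => ?_
  by_cases h : X ω = a
  · simp [h]
  · simp only [h, if_false]
    split_ifs <;> simp [hP]

/-- If `X` has constant probability mass `u` and the list `L (Y)` contains at most `K` values,
then `I(X;Y) ≥ P(X ∈ L(Y)) log t - t K u` for every `t > 0`. -/
lemma mutInfo_ge_of_list {Ω A B : Type*} [Fintype Ω] [Fintype A] [Fintype B]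
    [DecidableEq A] [DecidableEq B] {P : Ω → ℝ} (hP : ∀ ω, 0 ≤ P ω) (hP1 : ∑ ω, P ω = 1)
    (X : Ω → A) (Y : Ω → B) {u : ℝ} (hX : ∀ a, dist P X a = u)
    (L : B → Finset A) {K : ℝ} (hL : ∀ b, ((L b).card : ℝ) ≤ K) {t : ℝ} (ht : 0 < t) :
    (∑ ω, if X ω ∈ L (Y ω) then P ω else 0) * Real.log t - t * (K * u) ≤ mutInfo P X Y := by
  classical
  set p : A × B → ℝ := dist P (fun ω => (X ω, Y ω)) with hp
  set h : A × B → ℝ := fun x => if x.1 ∈ L x.2 then t else 1 with hh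
  have hhpos : ∀ x, 0 < h x := fun x => by simp only [hh]; split_ifs <;> simp [ht]
  have hY0 : ∀ b, 0 ≤ dist P Y b := dist_nonneg hP Y
  have hX0 : ∀ a, 0 ≤ dist P X a := dist_nonneg hP X
  have hterm : ∀ x : A × B,
      p x * Real.log (h x) + p x - dist P X x.1 * dist P Y x.2 * h x
        ≤ p x * Real.log (p x / (dist P X x.1 * dist P Y x.2)) := by
    intro x
    have hx0 : 0 ≤ p x := dist_nonneg hP _ x
    rcases hx0.eq_or_lt with hx | hx
    · rw [← hx]
      have := mul_nonneg (mul_nonneg (hX0 x.1) (hY0 x.2)) (hhpos x).le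
      simp only [zero_mul]
      linarith
    · have h1 : 0 < dist P X x.1 := hx.trans_le (dist_comp_le hP _ Prod.fst x)
      have h2 : 0 < dist P Y x.2 := hx.trans_le (dist_comp_le hP _ Prod.snd x)
      have hq : 0 < dist P X x.1 * dist P Y x.2 := mul_pos h1 h2
      set q := dist P X x.1 * dist P Y x.2
      have hlog := Real.one_sub_inv_le_log_of_pos (div_pos hx (mul_pos hq (hhpos x)))
      have hsplit : Real.log (p x / q) = Real.log (p x / (q * h x)) + Real.log (h x) := by
        rw [← Real.log_mul (div_pos hx (mul_pos hq (hhpos x))).ne' (hhpos x).ne']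
        congr 1
        have := (hhpos x).ne'
        field_simp
      have hmul := mul_le_mul_of_nonneg_left hlog hx.le
      have heq : p x * (1 - (p x / (q * h x))⁻¹) = p x - q * h x := by
        have := (hhpos x).ne'
        field_simp
      rw [heq] at hmul
      rw [hsplit]
      linarith
  have hsum := Finset.sum_le_sum fun x (_ : x ∈ Finset.univ) => hterm x
  rw [Finset.sum_sub_distrib, Finset.sum_add_distrib, sum_dist, hP1, sum_dist_mul] at hsum
  have hmi : mutInfo P X Y
      = ∑ x : A × B, p x * Real.log (p x / (dist P X x.1 * dist P Y x.2)) := by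
    rw [Fintype.sum_prod_type]
    rfl
  have hlogsum : ∑ ω, P ω * Real.log (h (X ω, Y ω))
      = (∑ ω, if X ω ∈ L (Y ω) then P ω else 0) * Real.log t := by
    rw [Finset.sum_mul]
    refine Finset.sum_congr rfl fun ω _ => ?_
    simp only [hh]
    split_ifs <;> simp
  have hΩ : Nonempty Ω := by
    by_contra hne
    have := not_nonempty_iff.mp hne
    simp at hP1
  obtain ⟨ω₀⟩ := hΩ
  have hu0 : 0 ≤ u := hX (X ω₀) ▸ hX0 _
  have hq : ∑ x : A × B, dist P X x.1 * dist P Y x.2 * h x ≤ 1 + t * (K * u) := by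
    have hle : ∀ x : A × B, dist P X x.1 * dist P Y x.2 * h x
        ≤ dist P X x.1 * dist P Y x.2 + dist P Y x.2 * (if x.1 ∈ L x.2 then t * u else 0) := by
      intro x
      have h1 := hX x.1
      have := mul_nonneg hu0 (hY0 x.2)
      simp only [hh, h1]
      split_ifs <;> nlinarith
    refine (Finset.sum_le_sum fun x _ => hle x).trans ?_
    rw [Finset.sum_add_distrib, Fintype.sum_prod_type]
    simp only
    rw [← Finset.sum_mul_sum, sum_dist, sum_dist, hP1, Fintype.sum_prod_type_right]
    simp only [← Finset.mul_sum, Finset.sum_ite_mem, Finset.univ_inter, Finset.sum_const,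
      nsmul_eq_mul]
    have : ∑ b, dist P Y b * (t * ((L b).card * u)) ≤ ∑ b, dist P Y b * (t * (K * u)) := by
      refine Finset.sum_le_sum fun b _ => mul_le_mul_of_nonneg_left ?_ (hY0 b)
      have := hL b
      gcongr
    rw [← Finset.sum_mul, sum_dist, hP1] at this
    linarith
  rw [hmi]
  linarith

lemma Code.P_nonneg {D n M C : ℕ} (c : Code D n M C) (ω) : 0 ≤ c.P ω :=
  mul_nonneg (by positivity) (c.q_nonneg _)

lemma Code.sum_P {D n M C : ℕ} (c : Code D n M C) (hM : 0 < M) : ∑ ω, c.P ω = 1 := by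
  have : (M : ℝ) ≠ 0 := by positivity
  simp only [Code.P, Fintype.sum_prod_type, ← Finset.mul_sum, c.q_sum]
  simp [this]

lemma Code.dist_fst {D n M C : ℕ} (c : Code D n M C) (w : Fin D → Fin M) :
    dist c.P (fun ω => ω.1) w = 1 / (M : ℝ) ^ D := by
  simp only [dist, Code.P, Fintype.sum_prod_type]
  rw [Finset.sum_eq_single w (fun b _ hb => by simp [hb]) (by simp)]
  simp [← Finset.mul_sum, c.q_sum]

/-- All demands `d` are decoded correctly at the outcome `ω`. -/
def Code.Decodes {D n M C : ℕ} (c : Code D n M C)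
    (ω : (Fin D → Fin M) × Fin (c.nr + 1)) : Prop :=
  ∀ d : Fin D × Fin D,
    c.dec d 0 (c.cacheF 0 (c.encC ω.1 ω.2)) (c.encD d ω.1 ω.2) = ω.1 d.1 ∧
    c.dec d 1 (c.cacheF 1 (c.encC ω.1 ω.2)) (c.encD d ω.1 ω.2) = ω.1 d.2

/-- If the adversary's observation determines a list of at most `K` libraries which contains the
true one whenever all demands are decoded, then small error and small leakage force the number
of libraries to be at most a constant times `K`. -/
lemma Code.card_library_le {D n M C : ℕ} (c : Code D n M C) (hM : 0 < M)
    (d : Fin D × Fin D) (S1 S2 : Finset (Fin n))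
    (L : (Fin n → Option Bool) × (Fin n → Option Bool) → Finset (Fin D → Fin M))
    {K : ℝ} (hK : 0 < K) (hL : ∀ z, ((L z).card : ℝ) ≤ K)
    (hmem : ∀ ω, c.Decodes ω → ω.1 ∈ L (tap S1 (c.encC ω.1 ω.2), tap S2 (c.encD d ω.1 ω.2)))
    {ε : ℝ} (herr : ∀ d, c.errProb d ≤ ε) (hε : (D : ℝ) * D * ε ≤ 1 / 2)
    (hleak : c.leak d S1 S2 ≤ 1) :
    (M : ℝ) ^ D ≤ Real.exp 4 * K := by
  have hMD : 0 < (M : ℝ) ^ D := by positivity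
  set p := ∑ ω, if ω.1 ∈ L (tap S1 (c.encC ω.1 ω.2), tap S2 (c.encD d ω.1 ω.2)) then c.P ω else 0
    with hp
  have hp2 : 1 / 2 ≤ p := by
    have h1 : 1 ≤ p + ∑ d, c.errProb d := by
      rw [← c.sum_P hM, hp]
      simp only [Code.errProb]
      rw [Finset.sum_comm, ← Finset.sum_add_distrib]
      refine Finset.sum_le_sum fun ω _ => ?_
      have hP := c.P_nonneg ω
      have hnn : ∀ d' ∈ (Finset.univ : Finset (Fin D × Fin D)), 0 ≤
          (if c.dec d' 0 (c.cacheF 0 (c.encC ω.1 ω.2)) (c.encD d' ω.1 ω.2) ≠ ω.1 d'.1 ∨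
            c.dec d' 1 (c.cacheF 1 (c.encC ω.1 ω.2)) (c.encD d' ω.1 ω.2) ≠ ω.1 d'.2
          then c.P ω else 0) := fun d' _ => by split_ifs <;> simp [hP]
      by_cases hω : c.Decodes ω
      · rw [if_pos (hmem ω hω)]
        have := Finset.sum_nonneg hnn
        linarith
      · obtain ⟨d', hd'⟩ := not_forall.mp hω
        have hs := Finset.single_le_sum hnn (Finset.mem_univ d')
        rw [if_pos (not_and_or.mp hd')] at hs
        split_ifs <;> linarith
    have h2 : ∑ d, c.errProb d ≤ (D : ℝ) * D * ε := by
      refine (Finset.sum_le_sum fun d _ => herr d).trans ?_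
      simp
    linarith
  have hmi := mutInfo_ge_of_list c.P_nonneg (c.sum_P hM) (fun ω => ω.1)
    (fun ω => (tap S1 (c.encC ω.1 ω.2), tap S2 (c.encD d ω.1 ω.2))) c.dist_fst L hL
    (div_pos hMD hK)
  have hone : (M : ℝ) ^ D / K * (K * (1 / (M : ℝ) ^ D)) = 1 := by field_simp
  rw [hone] at hmi
  have hlog : Real.log ((M : ℝ) ^ D / K) ≤ 4 := by
    by_contra! hlt
    have : p * Real.log ((M : ℝ) ^ D / K) - 1 ≤ 1 := hmi.trans hleak
    nlinarith
  rw [Real.log_le_iff_le_exp (div_pos hMD hK), div_le_iff₀ hK] at hlog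
  exact hlog

lemma card_tap_fiber_le {n : ℕ} (S : Finset (Fin n)) (z : Fin n → Option Bool) :
    (Finset.univ.filter fun x : Fin n → Bool => tap S x = z).card ≤ 2 ^ (n - S.card) := by
  have hcard : Fintype.card ({i // i ∈ Sᶜ} → Bool) = 2 ^ (n - S.card) := by
    simp
  rw [← hcard, ← Finset.card_univ]
  refine Finset.card_le_card_of_injOn (fun x i => x i.1) (by simp) ?_
  intro x hx y hy hxy
  simp only [Finset.coe_filter, Finset.mem_univ, true_and, Set.mem_ofPred_eq] at hx hy
  funext i
  by_cases hi : i ∈ S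
  · have := congrFun (hx.trans hy.symm) i
    simpa [tap, hi] using this
  · exact congrFun hxy ⟨i, by simpa using hi⟩

lemma card_le_card_image_pair_mul {m : ℕ} {α : Type*} [DecidableEq α]
    (A : Finset (Fin (m + 2) → α)) :
    A.card ≤ (A.image fun w => (w 0, w 1)).card
      * (A.image fun w (i : Fin m) => w i.succ.succ).card := by
  rw [← Finset.card_product]
  refine Finset.card_le_card_of_injOn (fun w => ((w 0, w 1), fun i => w i.succ.succ)) ?_ ?_
  · intro w hw
    simp only [Finset.coe_product, Set.mem_prod, Finset.mem_coe]
    exact ⟨Finset.mem_image_of_mem (fun w => (w 0, w 1)) hw,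
      Finset.mem_image_of_mem (fun w (i : Fin m) => w i.succ.succ) hw⟩
  · intro w _ w' _ h
    simp only [Prod.mk.injEq] at h
    funext i
    refine Fin.cases h.1.1 (fun i => Fin.cases h.1.2 (fun i => congrFun h.2 i) i) i

/-- The discrete Loomis–Whitney inequality in dimension three. -/
lemma card_sq_le_mul_mul_of_pairs {α : Type*} [DecidableEq α] (A : Finset (Fin 3 → α)) :
    A.card ^ 2 ≤ (A.image fun w => (w 0, w 1)).card * ((A.image fun w => (w 1, w 2)).card
      * (A.image fun w => (w 0, w 2)).card) := by
  set f : (Fin 3 → α) → α × α := fun w => (w 0, w 1) with hf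
  have hfib : A.card = ∑ b ∈ A.image f, (A.filter fun w => f w = b).card :=
    Finset.card_eq_sum_card_fiberwise fun w hw => Finset.mem_image_of_mem f hw
  rw [hfib]
  refine sq_sum_le_card_mul_sum_sq.trans (Nat.mul_le_mul_left _ ?_)
  rw [← Finset.card_product]
  simp only [sq, ← Finset.card_product]
  rw [← Finset.card_sigma]
  refine Finset.card_le_card_of_injOn
    (fun x => ((x.2.1 1, x.2.1 2), (x.2.2 0, x.2.2 2))) ?_ ?_
  · rintro ⟨b, w, w'⟩ h
    simp only [Finset.coe_sigma, Set.mem_sigma_iff, Finset.mem_coe, Finset.mem_product,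
      Finset.mem_filter] at h
    simp only [Finset.mem_coe, Finset.mem_product]
    exact ⟨Finset.mem_image_of_mem (fun w => (w 1, w 2)) h.2.1.1,
      Finset.mem_image_of_mem (fun w => (w 0, w 2)) h.2.2.1⟩
  · rintro ⟨b, w, w'⟩ h ⟨b', v, v'⟩ h' heq
    simp only [Finset.coe_sigma, Set.mem_sigma_iff, Finset.mem_coe, Finset.mem_product,
      Finset.mem_filter, hf] at h h'
    simp only [Prod.mk.injEq] at heq
    obtain ⟨-, ⟨-, h1⟩, -, h2⟩ := h
    obtain ⟨-, ⟨-, h3⟩, -, h4⟩ := h'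
    obtain ⟨b0, b1⟩ := b
    obtain ⟨b0', b1'⟩ := b'
    simp only [Prod.mk.injEq] at h1 h2 h3 h4
    have e0 : b0 = b0' := by rw [← h2.1, ← h4.1]; exact heq.2.1
    have e1 : b1 = b1' := by rw [← h1.2, ← h3.2]; exact heq.1.1
    subst e0 e1
    have hw : w = v := by
      funext i
      fin_cases i
      · exact h1.1.trans h3.1.symm
      · exact h1.2.trans h3.2.symm
      · exact heq.1.2
    have hw' : w' = v' := by
      funext i
      fin_cases i
      · exact h2.1.trans h4.1.symm
      · exact h2.2.trans h4.2.symm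
      · exact heq.2.2
    rw [hw, hw']

/-- A set of `D`-tuples, `D ≠ 1`, all of whose two-dimensional projections have at most `N`
elements, has at most `N ^ (D / 2)` elements. -/
lemma card_sq_le_pow_of_pairs {α : Type*} [DecidableEq α] (N : ℕ) :
    ∀ (D : ℕ), D ≠ 1 → ∀ A : Finset (Fin D → α),
      (∀ i j, (A.image fun w => (w i, w j)).card ≤ N) → A.card ^ 2 ≤ N ^ D
  | 0, _, A, _ => by
    have : A.card ≤ 1 := Finset.card_le_one_of_subsingleton A
    simpa using Nat.pow_le_pow_left this 2
  | 1, h, _, _ => absurd rfl h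
  | 3, _, A, hA => by
    refine (card_sq_le_mul_mul_of_pairs A).trans ?_
    calc _ ≤ N * (N * N) := by gcongr <;> apply hA
      _ = N ^ 3 := by ring
  | 2, _, A, hA => by
    have := card_le_card_image_pair_mul (m := 0) A
    have h1 : (A.image fun w (i : Fin 0) => w i.succ.succ).card ≤ 1 :=
      Finset.card_le_one_of_subsingleton _
    have h2 : A.card ≤ N := by
      calc A.card ≤ N * 1 := this.trans (Nat.mul_le_mul (hA 0 1) h1)
        _ = N := mul_one N
    exact Nat.pow_le_pow_left h2 2
  | m + 4, _, A, hA => by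
    have h := card_le_card_image_pair_mul (m := m + 2) A
    have ih := card_sq_le_pow_of_pairs N (m + 2) (by omega)
      (A.image fun w (i : Fin (m + 2)) => w i.succ.succ) (fun i j => by
        rw [Finset.image_image]
        exact hA i.succ.succ j.succ.succ)
    calc A.card ^ 2 ≤ (N * (A.image fun w (i : Fin (m + 2)) => w i.succ.succ).card) ^ 2 :=
          Nat.pow_le_pow_left (h.trans (Nat.mul_le_mul_right _ (hA 0 1))) 2
      _ ≤ N ^ 2 * N ^ (m + 2) := by rw [mul_pow]; exact Nat.mul_le_mul_left _ ih
      _ = N ^ (m + 4) := by ring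

/-- The size of the library when the adversary taps the positions `S` of the cache placement. -/
lemma Code.card_library_le_of_tap_placement {D n M C : ℕ} (hD : 2 < D) (c : Code D n M C)
    (hM : 0 < M) (d : Fin D × Fin D) (S : Finset (Fin n)) {ε : ℝ}
    (herr : ∀ d, c.errProb d ≤ ε) (hε : (D : ℝ) * D * ε ≤ 1 / 2)
    (hleak : c.leak d S ∅ ≤ 1) :
    (M : ℝ) ^ D ≤ Real.exp 4 * (2 ^ (n - S.card) * √(2 ^ (n * D))) := by
  classical
  set T : (Fin n → Bool) → Finset (Fin D → Fin M) := fun x =>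
    Finset.univ.filter fun w => ∀ i j, ∃ y,
      c.dec (i, j) 0 (c.cacheF 0 x) y = w i ∧ c.dec (i, j) 1 (c.cacheF 1 x) y = w j with hT
  have hTcard : ∀ x, ((T x).card : ℝ) ≤ √(2 ^ (n * D)) := by
    intro x
    apply Real.le_sqrt_of_sq_le
    have := card_sq_le_pow_of_pairs (2 ^ n) D (by omega) (T x) (fun i j => by
      have hcard : Fintype.card (Fin n → Bool) = 2 ^ n := by simp
      rw [← hcard, ← Finset.card_univ]
      refine (Finset.card_le_card (t := Finset.univ.image fun y =>
        (c.dec (i, j) 0 (c.cacheF 0 x) y, c.dec (i, j) 1 (c.cacheF 1 x) y)) ?_).trans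
        Finset.card_image_le
      intro b hb
      obtain ⟨w, hw, rfl⟩ := Finset.mem_image.mp hb
      obtain ⟨y, h0, h1⟩ := (Finset.mem_filter.mp hw).2 i j
      exact Finset.mem_image.mpr ⟨y, Finset.mem_univ _, by rw [h0, h1]⟩)
    rw [← pow_mul] at this
    exact_mod_cast this
  refine c.card_library_le hM d S ∅
    (fun z => (Finset.univ.filter fun x => tap S x = z.1).biUnion T) (by positivity) ?_ ?_
    herr hε hleak
  · intro z
    calc (((Finset.univ.filter fun x => tap S x = z.1).biUnion T).card : ℝ)
        ≤ ∑ x ∈ Finset.univ.filter fun x => tap S x = z.1, ((T x).card : ℝ) := by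
          exact_mod_cast Finset.card_biUnion_le
      _ ≤ ∑ x ∈ Finset.univ.filter fun x => tap S x = z.1, √(2 ^ (n * D)) :=
          Finset.sum_le_sum fun x _ => hTcard x
      _ = (Finset.univ.filter fun x => tap S x = z.1).card * √(2 ^ (n * D)) := by simp
      _ ≤ _ := by
          gcongr
          exact_mod_cast card_tap_fiber_le S z.1
  · intro ω hω
    simp only [Finset.mem_biUnion, Finset.mem_filter, Finset.mem_univ, true_and, hT]
    exact ⟨c.encC ω.1 ω.2, rfl, fun i j => ⟨c.encD (i, j) ω.1 ω.2, hω (i, j)⟩⟩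

/-- The number of pairs of files when the adversary taps the whole cache placement transmission
and the positions `S` of the delivery transmission. -/
lemma Code.card_pair_le_of_tap_delivery {m n M C : ℕ} (c : Code (m + 2) n M C)
    (hM : 0 < M) (S : Finset (Fin n)) {ε : ℝ}
    (herr : ∀ d, c.errProb d ≤ ε) (hε : ((m + 2 : ℕ) : ℝ) * (m + 2 : ℕ) * ε ≤ 1 / 2)
    (hleak : c.leak (0, 1) Finset.univ S ≤ 1) :
    (M : ℝ) ^ 2 ≤ Real.exp 4 * 2 ^ (n - S.card) := by
  classical
  set T : (Fin n → Bool) → (Fin n → Bool) → Fin M × Fin M := fun x y =>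
    (c.dec (0, 1) 0 (c.cacheF 0 x) y, c.dec (0, 1) 1 (c.cacheF 1 x) y) with hT
  set L : (Fin n → Option Bool) × (Fin n → Option Bool) → Finset (Fin (m + 2) → Fin M) :=
    fun z => Finset.univ.filter fun w => ∃ x y, tap Finset.univ x = z.1 ∧ tap S y = z.2 ∧
      T x y = (w 0, w 1) with hLdef
  have htap : ∀ x x' : Fin n → Bool, tap Finset.univ x = tap Finset.univ x' → x = x' := by
    intro x x' h
    funext i
    simpa [tap] using congrFun h i
  have hL : ∀ z, ((L z).card : ℝ) ≤ 2 ^ (n - S.card) * (M : ℝ) ^ m := by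
    intro z
    have hpair : ((L z).image fun w => (w 0, w 1)).card ≤ 2 ^ (n - S.card) := by
      rcases (L z).eq_empty_or_nonempty with h | ⟨w₀, hw₀⟩
      · simp [h]
      obtain ⟨x₀, -, hx₀, -, -⟩ := (Finset.mem_filter.mp hw₀).2
      refine (Finset.card_le_card
        (t := (Finset.univ.filter fun y => tap S y = z.2).image (T x₀)) ?_).trans
        (Finset.card_image_le.trans (card_tap_fiber_le S z.2))
      intro b hb
      obtain ⟨w, hw, rfl⟩ := Finset.mem_image.mp hb
      obtain ⟨x, y, hx, hy, hxy⟩ := (Finset.mem_filter.mp hw).2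
      obtain rfl := htap x x₀ (hx.trans hx₀.symm)
      exact Finset.mem_image.mpr ⟨y, by simpa using hy, hxy⟩
    have hrest : ((L z).image fun w (i : Fin m) => w i.succ.succ).card ≤ M ^ m :=
      (Finset.card_le_univ _).trans (by simp)
    exact_mod_cast (card_le_card_image_pair_mul (L z)).trans (Nat.mul_le_mul hpair hrest)
  have hfin := c.card_library_le hM (0, 1) Finset.univ S L (by positivity) hL (fun ω hω => by
    simp only [hLdef, Finset.mem_filter, Finset.mem_univ, true_and]
    refine ⟨_, _, rfl, rfl, ?_⟩
    obtain ⟨h0, h1⟩ := hω (0, 1)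
    simp only [hT, h0, h1]) herr hε hleak
  have hMm : 0 < (M : ℝ) ^ m := by positivity
  refine le_of_mul_le_mul_right ?_ hMm
  calc (M : ℝ) ^ 2 * (M : ℝ) ^ m = (M : ℝ) ^ (m + 2) := by ring
    _ ≤ _ := hfin
    _ = _ := by ring

lemma le_log_msgCount {n : ℕ} {R : ℝ} (hR : 0 ≤ R) :
    0 < msgCount n R ∧ (n * R - 1) * Real.log 2 ≤ Real.log (msgCount n R) := by
  have h1 : (1 : ℝ) ≤ 2 ^ ((n : ℝ) * R) := Real.one_le_rpow one_le_two (by positivity)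
  have hpos : 0 < msgCount n R := Nat.floor_pos.mpr h1
  refine ⟨hpos, ?_⟩
  have hlt := Nat.lt_floor_add_one ((2 : ℝ) ^ ((n : ℝ) * R))
  have hge : (1 : ℝ) ≤ (msgCount n R : ℝ) := by exact_mod_cast hpos
  have hhalf : (2 : ℝ) ^ ((n : ℝ) * R - 1) ≤ msgCount n R := by
    rw [Real.rpow_sub_one two_ne_zero]
    change _ < (msgCount n R : ℝ) + 1 at hlt
    linarith
  rw [← Real.log_rpow two_pos]
  exact Real.log_le_log (by positivity) hhalf

lemma nonpos_of_eventually_mul_le {a b : ℝ} (h : ∀ᶠ n : ℕ in atTop, (n : ℝ) * a ≤ b) :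
    a ≤ 0 := by
  by_contra! ha
  have ht : Tendsto (fun n : ℕ => (n : ℝ) * a) atTop atTop :=
    tendsto_natCast_atTop_atTop.atTop_mul_const ha
  obtain ⟨n, h1, h2⟩ := (h.and (ht.eventually_gt_atTop b)).exists
  linarith

lemma rate_le_of_placement {D : ℕ} (hD : 2 < D) {α R : ℝ} (hach : Achievable D α R)
    (hR : 0 ≤ R) (h0 : 0 < α) (h1 : α < 1) : R ≤ 1 / 2 + 1 / D * (1 - α) := by
  obtain ⟨c, ε, δ, hε, hδ, herr, hleak⟩ := hach
  have hDpos : (0 : ℝ) < D := by positivity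
  have hlog2 : 0 < Real.log 2 := Real.log_pos one_lt_two
  have hε' : ∀ᶠ n in atTop, (D : ℝ) * D * ε n < 1 / 2 := by
    have : Tendsto (fun n => (D : ℝ) * D * ε n) atTop (nhds 0) := by
      simpa using hε.const_mul ((D : ℝ) * D)
    exact this.eventually_lt_const (by norm_num)
  have hδ' : ∀ᶠ n in atTop, δ n < 1 := hδ.eventually_lt_const one_pos
  have key : (D * R - (1 - α) - D / 2) * Real.log 2 ≤ 0 := by
    refine nonpos_of_eventually_mul_le (b := 4 + (1 + D) * Real.log 2) ?_
    filter_upwards [hε', hδ'] with n hεn hδn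
    have hsn : ⌊α * n⌋₊ ≤ n := by
      refine Nat.floor_le_of_le ?_
      have : (0 : ℝ) ≤ n := Nat.cast_nonneg n
      nlinarith
    obtain ⟨S, -, hS⟩ := Finset.exists_subset_card_eq
      (s := (Finset.univ : Finset (Fin n))) (n := ⌊α * n⌋₊) (by simpa using hsn)
    obtain ⟨hM, hMlog⟩ := le_log_msgCount (n := n) hR
    have hMpos : (0 : ℝ) < msgCount n R := by exact_mod_cast hM
    have hb := (c n).card_library_le_of_tap_placement hD hM (⟨0, by omega⟩, ⟨0, by omega⟩) S
      (herr n) hεn.le (by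
        refine (le_abs_self _).trans ((hleak n _ S ∅ ?_).trans hδn.le)
        simpa [hS] using Nat.floor_le (mul_nonneg h0.le (Nat.cast_nonneg n)))
    have hl := Real.log_le_log (by positivity) hb
    rw [Real.log_mul (Real.exp_pos 4).ne' (by positivity), Real.log_mul (by positivity)
      (by positivity), Real.log_exp, Real.log_sqrt (by positivity), Real.log_pow, Real.log_pow,
      Real.log_pow, hS, Nat.cast_sub hsn] at hl
    push_cast at hl
    have hs := Nat.lt_floor_add_one (α * n)
    have e1 := mul_le_mul_of_nonneg_left hMlog hDpos.le
    have e2 := mul_le_mul_of_nonneg_right hs.le hlog2.le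
    nlinarith
  have hle : D * R - (1 - α) - D / 2 ≤ 0 := nonpos_of_mul_nonpos_left key hlog2
  have hfin : R * D ≤ (1 / 2 + 1 / D * (1 - α)) * D := by
    have : (1 / 2 + 1 / D * (1 - α)) * D = D / 2 + (1 - α) := by field_simp
    linarith
  exact le_of_mul_le_mul_right hfin hDpos

lemma rate_le_of_delivery {m : ℕ} {α R : ℝ} (hach : Achievable (m + 2) α R)
    (hR : 0 ≤ R) (h1 : 1 ≤ α) (h2 : α ≤ 2) : R ≤ 1 - α / 2 := by
  obtain ⟨c, ε, δ, hε, hδ, herr, hleak⟩ := hach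
  have hlog2 : 0 < Real.log 2 := Real.log_pos one_lt_two
  have hε' : ∀ᶠ n in atTop, ((m + 2 : ℕ) : ℝ) * (m + 2 : ℕ) * ε n < 1 / 2 := by
    have : Tendsto (fun n => ((m + 2 : ℕ) : ℝ) * (m + 2 : ℕ) * ε n) atTop (nhds 0) := by
      simpa using hε.const_mul (((m + 2 : ℕ) : ℝ) * (m + 2 : ℕ))
    exact this.eventually_lt_const (by norm_num)
  have hδ' : ∀ᶠ n in atTop, δ n < 1 := hδ.eventually_lt_const one_pos
  have key : (2 * R - (2 - α)) * Real.log 2 ≤ 0 := by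
    refine nonpos_of_eventually_mul_le (b := 4 + 3 * Real.log 2) ?_
    filter_upwards [hε', hδ'] with n hεn hδn
    have hn : (0 : ℝ) ≤ n := Nat.cast_nonneg n
    have hsn : ⌊(α - 1) * n⌋₊ ≤ n := Nat.floor_le_of_le (by nlinarith)
    obtain ⟨S, -, hS⟩ := Finset.exists_subset_card_eq
      (s := (Finset.univ : Finset (Fin n))) (n := ⌊(α - 1) * n⌋₊) (by simpa using hsn)
    obtain ⟨hM, hMlog⟩ := le_log_msgCount (n := n) hR
    have hMpos : (0 : ℝ) < msgCount n R := by exact_mod_cast hM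
    have hb := (c n).card_pair_le_of_tap_delivery hM S (herr n) hεn.le (by
        refine (le_abs_self _).trans ((hleak n _ Finset.univ S ?_).trans hδn.le)
        have := Nat.floor_le (mul_nonneg (sub_nonneg.mpr h1) hn)
        simp only [Finset.card_univ, Fintype.card_fin, hS]
        linarith)
    have hl := Real.log_le_log (by positivity) hb
    rw [Real.log_mul (Real.exp_pos 4).ne' (by positivity), Real.log_exp, Real.log_pow,
      Real.log_pow, hS, Nat.cast_sub hsn] at hl
    push_cast at hl
    have hs := Nat.lt_floor_add_one ((α - 1) * n)
    have e2 := mul_le_mul_of_nonneg_right hs.le hlog2.le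
    nlinarith
  have hle : 2 * R - (2 - α) ≤ 0 := nonpos_of_mul_nonpos_left key hlog2
  linarith

end CBC

open CBC in
/-- **Theorem 3.** For a library of `D > 2` files, every file rate `R_s`
achievable with strong secrecy satisfies
`R_s ≤ 1/2 + ((2D-1)/(2D(D-1)))(1-α)` when `0 < α < 1`, and `R_s ≤ 1 - α/2`
when `1 ≤ α ≤ 2`. -/
theorem secrecy_rate_upper_bound_many_files (D : ℕ) (hD : 2 < D) (α Rs : ℝ)
    (hach : Achievable D α Rs) :
    (0 < α → α < 1 →
      Rs ≤ 1/2 + ((2*(D:ℝ) - 1)/(2*(D:ℝ)*((D:ℝ) - 1))) * (1 - α)) ∧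
    (1 ≤ α → α ≤ 2 → Rs ≤ 1 - α/2) := by
  have hD' : (2 : ℝ) < D := by exact_mod_cast hD
  rcases le_or_gt 0 Rs with hR | hR
  · refine ⟨fun h0 h1 => (rate_le_of_placement hD hach hR h0 h1).trans ?_, fun h1 h2 => ?_⟩
    · have : 1 / (D : ℝ) ≤ (2 * (D : ℝ) - 1) / (2 * (D : ℝ) * ((D : ℝ) - 1)) := by
        rw [div_le_div_iff₀ (by linarith) (by nlinarith)]
        nlinarith
      have := mul_le_mul_of_nonneg_right this (sub_nonneg.mpr h1.le)
      linarith
    · obtain ⟨m, rfl⟩ := Nat.exists_eq_add_of_le' hD.le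
      exact rate_le_of_delivery hach hR h1 h2
  · refine ⟨fun h0 h1 => ?_, fun h1 h2 => by linarith⟩
    have : 0 ≤ (2 * (D : ℝ) - 1) / (2 * (D : ℝ) * ((D : ℝ) - 1)) * (1 - α) :=
      mul_nonneg (div_nonneg (by linarith) (by nlinarith)) (by linarith)
    linarith
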